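/- Let f : F_q → F_p satisfy W_f(0) = Σ_{x∈F_q} ξ_p^{f(x)} = ε √(p*)^{n+s}, where ε ∈ {±1} and 0 ≤ s ≤ n. For j ∈ F_p let N_f(j) = #{x ∈ F_q : f(x) = j}. If n+s is even, then N_f(0) = p^{n−1} + ε η_0(−1)(p−1)√(p*)^{n+s−2} and N_f(j) = p^{n−1} − ε η_0(−1)√(p*)^{n+s−2} for every j ∈ F_p^*. If n+s is odd, then N_f(0) = p^{n−1}, N_f(j) = p^{n−1} + ε √(p*)^{n+s−1} for j ∈ SQ, and N_f(j) = p^{n−1} − ε √(p*)^{n+s−1} for j ∈ NSQ. (When the exponent of √(p*) is even, √(p*)^{2k} = (p*)^k is an integer, so all stated values are integers.) -/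

import Mathlib

open scoped BigOperators Classical

noncomputable section

/-- `ξ_p^j` for `j : ZMod p`, where `ξ_p = exp(2πi/p)` and the exponent `j`
is lifted to a natural number. -/
def ep (p : ℕ) (j : ZMod p) : ℂ :=
  Complex.exp (2 * Real.pi * Complex.I * (j.val : ℂ) / (p : ℂ))

/-- `√(p*)`: equal to `√p` if `p ≡ 1 (mod 4)` and to `i√p` if `p ≡ 3 (mod 4)`. -/
def sqrtPStar (p : ℕ) : ℂ :=
  if p % 4 = 1 then ((Real.sqrt p : ℝ) : ℂ) else Complex.I * ((Real.sqrt p : ℝ) : ℂ)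

/-- The quadratic character `η₀` of `F_p` (extended by `η₀(0) = 0`), with values in `ℂ`. -/
def eta0 (p : ℕ) [Fact p.Prime] (j : ZMod p) : ℂ :=
  ((quadraticChar (ZMod p) j : ℤ) : ℂ)

/-- The Walsh transform of `f : F_q → F_p`. -/
def walsh (p : ℕ) {F : Type*} [Field F] [Fintype F] [Algebra (ZMod p) F]
    (f : F → ZMod p) (β : F) : ℂ :=
  ∑ x : F, ep p (f x - Algebra.trace (ZMod p) F (β * x))

/-- `f` is weakly regular `s`-plateaued with sign `ε` and dual `g`:
`W_f(β) = ε √(p*)^{n+s} ξ_p^{g(β)}` on the Walsh support, `W_f(β) = 0` off it,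
and `g` vanishes off the Walsh support. -/
def IsWeaklyRegularPlateaued (p n s : ℕ) {F : Type*} [Field F] [Fintype F]
    [Algebra (ZMod p) F] (f : F → ZMod p) (ε : ℂ) (g : F → ZMod p) : Prop :=
  (ε = 1 ∨ ε = -1) ∧
  (∀ β : F, walsh p f β ≠ 0 →
      walsh p f β = ε * sqrtPStar p ^ (n + s) * ep p (g β)) ∧
  (∀ β : F, walsh p f β = 0 → g β = 0)

/-- `f` lies in the class `WRP`: weakly regular `s`-plateaued with sign `ε` and dual `g`,
unbalanced, `f(0) = 0`, and `f(ax) = a^h f(x)` for some positive even `h` with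
`gcd(h-1, p-1) = 1`. -/
def IsWRP (p n s : ℕ) {F : Type*} [Field F] [Fintype F]
    [Algebra (ZMod p) F] (f : F → ZMod p) (ε : ℂ) (g : F → ZMod p) : Prop :=
  IsWeaklyRegularPlateaued p n s f ε g ∧
  walsh p f 0 ≠ 0 ∧
  f 0 = 0 ∧
  ∃ h : ℕ, 0 < h ∧ Even h ∧ Nat.gcd (h - 1) (p - 1) = 1 ∧
    ∀ (a : (ZMod p)ˣ) (x : F),
      f (algebraMap (ZMod p) F (a : ZMod p) * x) = (a : ZMod p) ^ h * f x

/-- The Gaussian binomial coefficient `[n choose k]_q`. -/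
def gaussBinom {R : Type*} [CommRing R] (q : R) : ℕ → ℕ → R
  | _, 0 => 1
  | 0, _ + 1 => 0
  | n + 1, k + 1 => gaussBinom q n k + q ^ (k + 1) * gaussBinom q n (k + 1)

section GaussBinom

variable {R : Type*} [CommRing R] (q : R)

@[simp] lemma gaussBinom_zero_right (n : ℕ) : gaussBinom q n 0 = 1 := by
  cases n <;> rfl

@[simp] lemma gaussBinom_zero_succ (k : ℕ) : gaussBinom q 0 (k + 1) = 0 := rfl

lemma gaussBinom_succ_succ (n k : ℕ) :
    gaussBinom q (n + 1) (k + 1) = gaussBinom q n k + q ^ (k + 1) * gaussBinom q n (k + 1) := rfl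

lemma gaussBinom_eq_zero_of_lt {n k : ℕ} (h : n < k) : gaussBinom q n k = 0 := by
  induction n generalizing k with
  | zero => obtain ⟨k, rfl⟩ := Nat.exists_eq_succ_of_ne_zero h.ne'; rfl
  | succ n ih =>
    obtain ⟨k, rfl⟩ := Nat.exists_eq_succ_of_ne_zero (Nat.ne_zero_of_lt h)
    rw [Nat.succ_eq_add_one, gaussBinom_succ_succ, ih (by omega), ih (by omega)]
    simp

/-- The second Pascal rule. -/
lemma gaussBinom_succ_succ' {n k : ℕ} (h : k ≤ n) :
    gaussBinom q (n + 1) (k + 1) = q ^ (n - k) * gaussBinom q n k + gaussBinom q n (k + 1) := by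
  induction n generalizing k with
  | zero =>
    obtain rfl : k = 0 := by omega
    simp [gaussBinom_succ_succ]
  | succ n ih =>
    cases k with
    | zero =>
      have h1 := ih (Nat.zero_le n)
      have h2 := gaussBinom_succ_succ q n 0
      rw [gaussBinom_succ_succ q (n + 1)]
      simp only [gaussBinom_zero_right, Nat.sub_zero] at h1 h2 ⊢
      linear_combination q * h1 - h2
    | succ k =>
      rcases Nat.lt_or_ge k n with hk | hk
      · have h1 := ih (k := k) (by omega)
        have h2 := ih (k := k + 1) (by omega)
        obtain ⟨d, rfl⟩ : ∃ d, n = k + 1 + d := ⟨n - (k + 1), by omega⟩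
        rw [show k + 1 + d - k = d + 1 by omega] at h1
        rw [Nat.add_sub_cancel_left] at h2
        rw [show k + 1 + d + 1 - (k + 1) = d + 1 by omega, gaussBinom_succ_succ]
        linear_combination h1 + q ^ (k + 2) * h2 -
          q ^ (d + 1) * gaussBinom_succ_succ q (k + 1 + d) k -
          gaussBinom_succ_succ q (k + 1 + d) (k + 1)
      · obtain rfl : k = n := by omega
        rw [gaussBinom_succ_succ, gaussBinom_eq_zero_of_lt q (show k + 1 < k + 1 + 1 by omega)]
        simp

lemma one_sub_pow_mul_gaussBinom_succ {n k : ℕ} (h : k ≤ n) :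
    (1 - q ^ (k + 1)) * gaussBinom q n (k + 1) = (1 - q ^ (n - k)) * gaussBinom q n k := by
  have h1 := gaussBinom_succ_succ' q h
  rw [gaussBinom_succ_succ] at h1
  linear_combination -h1

/-- The alternating sum of the Gaussian binomial coefficients `[n choose j]_q`. -/
def altSumGaussBinom (n : ℕ) : R :=
  ∑ j ∈ Finset.range (n + 1), (-1) ^ j * gaussBinom q n j

lemma altSumGaussBinom_eq_sum_add_one (n : ℕ) : altSumGaussBinom q n =
    ∑ j ∈ Finset.range (n + 1), (-1) ^ (j + 1) * gaussBinom q n (j + 1) + 1 := by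
  have := Finset.sum_range_succ' (fun j => (-1) ^ j * gaussBinom q n j) (n + 1)
  rw [Finset.sum_range_succ, gaussBinom_eq_zero_of_lt q (Nat.lt_succ_self n)] at this
  simpa [altSumGaussBinom] using this

lemma altSumGaussBinom_add_two (n : ℕ) :
    altSumGaussBinom q (n + 2) = (1 - q ^ (n + 1)) * altSumGaussBinom q n := by
  have step (m : ℕ) : altSumGaussBinom q (m + 1) = altSumGaussBinom q m -
      ∑ j ∈ Finset.range (m + 1), (-1) ^ j * q ^ (m - j) * gaussBinom q m j := by
    rw [altSumGaussBinom_eq_sum_add_one q m, altSumGaussBinom, Finset.sum_range_succ', add_sub_right_comm,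
      ← Finset.sum_sub_distrib]
    congr 1
    · refine Finset.sum_congr rfl fun j hj => ?_
      rw [gaussBinom_succ_succ' q (Finset.mem_range_succ_iff.mp hj)]
      ring
    · simp
  have key : ∑ j ∈ Finset.range (n + 1 + 1), (-1) ^ j * q ^ (n + 1 - j) * gaussBinom q (n + 1) j =
      q ^ (n + 1) * altSumGaussBinom q n -
        ∑ j ∈ Finset.range (n + 1), (-1) ^ j * q ^ (n - j) * gaussBinom q n j := by
    rw [altSumGaussBinom_eq_sum_add_one, Finset.sum_range_succ', mul_add, add_sub_right_comm, Finset.mul_sum,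
      ← Finset.sum_sub_distrib]
    congr 1
    · refine Finset.sum_congr rfl fun j hj => ?_
      have hj' := Finset.mem_range_succ_iff.mp hj
      rw [gaussBinom_succ_succ, Nat.add_sub_add_right]
      have : q ^ (n + 1) = q ^ (n - j) * q ^ (j + 1) := by
        rw [← pow_add]; congr 1; omega
      rw [this]
      ring
    · simp
  have h1 := step (n + 1)
  have h2 := step n
  rw [key] at h1
  linear_combination h1 + h2

lemma altSumGaussBinom_two_mul (m : ℕ) :
    altSumGaussBinom q (2 * m) = ∏ r ∈ Finset.range m, (1 - q ^ (2 * r + 1)) := by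
  induction m with
  | zero => simp [altSumGaussBinom]
  | succ m ih => rw [Finset.prod_range_succ, ← ih, mul_add_one, altSumGaussBinom_add_two, mul_comm]

end GaussBinom

/-- The specialisation of Gauss's identity at a primitive root of unity of odd order. -/
lemma IsPrimitiveRoot.sum_pow_triangular {K : Type*} [Field K] {z : K} {m : ℕ}
    (hz : IsPrimitiveRoot z (2 * m + 1)) :
    ∑ j ∈ Finset.range (2 * m + 1), z⁻¹ ^ (j * (j + 1) / 2) =
      ∏ r ∈ Finset.range m, (1 - z ^ (2 * r + 1)) := by
  rw [← altSumGaussBinom_two_mul, altSumGaussBinom]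
  refine Finset.sum_congr rfl fun j hj => ?_
  have hz0 : z ≠ 0 := hz.ne_zero (by omega)
  have hg : ∀ j ≤ 2 * m, gaussBinom z (2 * m) j = (-1) ^ j * z⁻¹ ^ (j * (j + 1) / 2) := by
    intro j hj
    induction j with
    | zero => simp
    | succ j ih =>
      have h1 := one_sub_pow_mul_gaussBinom_succ z (n := 2 * m) (k := j) (by omega)
      rw [ih (by omega)] at h1
      have hne : 1 - z ^ (j + 1) ≠ 0 :=
        sub_ne_zero.mpr (hz.pow_ne_one_of_pos_of_lt (by omega) (by omega)).symm
      have e : z ^ (2 * m - j) = z⁻¹ ^ (j + 1) := by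
        rw [inv_pow]
        refine eq_inv_of_mul_eq_one_left ?_
        rw [← pow_add, ← hz.pow_eq_one]
        congr 1; omega
      have e2 : (j + 1) * (j + 1 + 1) / 2 = j * (j + 1) / 2 + (j + 1) := by
        rw [show (j + 1) * (j + 1 + 1) = j * (j + 1) + (j + 1) * 2 by ring,
          Nat.add_mul_div_right _ _ two_pos]
      have e3 : z⁻¹ ^ (j + 1) * z ^ (j + 1) = 1 := by
        rw [← mul_pow, inv_mul_cancel₀ hz0, one_pow]
      apply mul_left_cancel₀ hne
      rw [h1, e, e2, pow_add, pow_succ (-1)]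
      linear_combination (-1) ^ j * z⁻¹ ^ (j * (j + 1) / 2) * (-e3)
  rw [hg j (Finset.mem_range_succ_iff.mp hj), ← mul_assoc, ← mul_pow]
  simp

lemma ep_eq_stdAddChar (p : ℕ) [NeZero p] (j : ZMod p) : ep p j = ZMod.stdAddChar j := by
  conv_rhs => rw [← ZMod.natCast_zmod_val j]
  rw [← Int.cast_natCast, ZMod.stdAddChar_coe, ep, Int.cast_natCast]

lemma isPrimitiveRoot_stdAddChar (p : ℕ) [Fact p.Prime] {a : ZMod p} (ha : a ≠ 0) :
    IsPrimitiveRoot (ZMod.stdAddChar a) p := by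
  have h : orderOf (ZMod.stdAddChar a) = p := by
    refine orderOf_eq_prime ?_ fun h => ha ?_
    · rw [← AddChar.map_nsmul_eq_pow]
      simp
    · exact ZMod.injective_stdAddChar (h.trans (AddChar.map_zero_eq_one _).symm)
  simpa only [h] using IsPrimitiveRoot.orderOf (ZMod.stdAddChar a)

lemma sum_range_natCast_zmod {M : Type*} [AddCommMonoid M] (p : ℕ) [NeZero p] (g : ZMod p → M) :
    ∑ j ∈ Finset.range p, g j = ∑ x : ZMod p, g x := by
  refine Finset.sum_bij' (fun j _ => (j : ZMod p)) (fun x _ => x.val) ?_ ?_ ?_ ?_ ?_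
  · simp
  · intro x _
    exact Finset.mem_range.mpr (ZMod.val_lt x)
  · intro j hj
    exact ZMod.val_cast_of_lt (Finset.mem_range.mp hj)
  · simp
  · simp

lemma sum_stdAddChar_sq_eq_prod (p m : ℕ) [Fact p.Prime] (hm : p = 2 * m + 1) :
    ∑ x : ZMod p, ZMod.stdAddChar (x ^ 2) = ∏ r ∈ Finset.range m,
      (ZMod.stdAddChar (2 * r + 1 : ZMod p) - ZMod.stdAddChar (-(2 * r + 1) : ZMod p)) := by
  have hcast : (2 : ZMod p) * m + 1 = 0 := by
    have := ZMod.natCast_self p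
    rw [congrArg (Nat.cast (R := ZMod p)) hm] at this
    exact_mod_cast this
  have h2 : (-2 : ZMod p) ≠ 0 := by
    refine neg_ne_zero.mpr (Ring.two_ne_zero ?_)
    rw [ZMod.ringChar_zmod_n]
    omega
  have key := (hm ▸ isPrimitiveRoot_stdAddChar p h2 :
    IsPrimitiveRoot (ZMod.stdAddChar (-2 : ZMod p)) (2 * m + 1)).sum_pow_triangular
  rw [← hm] at key
  have hl : ∑ j ∈ Finset.range p, (ZMod.stdAddChar (-2 : ZMod p))⁻¹ ^ (j * (j + 1) / 2) =
      ∑ x : ZMod p, ZMod.stdAddChar (x ^ 2 + x) := by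
    rw [← sum_range_natCast_zmod]
    refine Finset.sum_congr rfl fun j _ => ?_
    rw [← AddChar.map_neg_eq_inv, ← AddChar.map_nsmul_eq_pow, neg_neg, nsmul_eq_mul]
    congr 1
    have : j * (j + 1) / 2 * 2 = j * (j + 1) :=
      Nat.div_mul_cancel (Nat.even_mul_succ_self j).two_dvd
    have := congrArg (Nat.cast (R := ZMod p)) this
    push_cast at this
    rw [this]
    ring
  have hr : ∏ r ∈ Finset.range m, (1 - ZMod.stdAddChar (-2 : ZMod p) ^ (2 * r + 1)) =
      ZMod.stdAddChar (-(m : ZMod p) ^ 2) * ∏ r ∈ Finset.range m,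
        (ZMod.stdAddChar (2 * r + 1 : ZMod p) - ZMod.stdAddChar (-(2 * r + 1) : ZMod p)) := by
    have hsum : ∀ k : ℕ, ZMod.stdAddChar (-(k : ZMod p) ^ 2) =
        ∏ r ∈ Finset.range k, ZMod.stdAddChar (-(2 * r + 1) : ZMod p) := by
      intro k
      induction k with
      | zero => simp
      | succ k ih =>
        rw [Finset.prod_range_succ, ← ih, ← AddChar.map_add_eq_mul]
        congr 1
        push_cast
        ring
    rw [hsum, ← Finset.prod_mul_distrib]
    refine Finset.prod_congr rfl fun r _ => ?_
    rw [mul_sub, ← AddChar.map_add_eq_mul, ← AddChar.map_add_eq_mul, ← AddChar.map_nsmul_eq_pow,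
      neg_add_cancel, AddChar.map_zero_eq_one]
    congr 2
    simp
    ring
  rw [hl, hr] at key
  rw [← Equiv.sum_comp (Equiv.subRight (m : ZMod p))]
  have hshift : ∀ x : ZMod p, ZMod.stdAddChar (Equiv.subRight (m : ZMod p) x ^ 2) =
      ZMod.stdAddChar ((m : ZMod p) ^ 2) * ZMod.stdAddChar (x ^ 2 + x) := by
    intro x
    rw [← AddChar.map_add_eq_mul]
    congr 1
    rw [Equiv.subRight_apply]
    linear_combination -x * hcast
  simp_rw [hshift]
  rw [← Finset.mul_sum, key, ← mul_assoc, ← AddChar.map_add_eq_mul, add_neg_cancel,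
    AddChar.map_zero_eq_one, one_mul]

lemma stdAddChar_sub_stdAddChar_neg (p k : ℕ) [NeZero p] :
    ZMod.stdAddChar (k : ZMod p) - ZMod.stdAddChar (-(k : ZMod p)) =
      2 * Complex.I * (Real.sin (2 * Real.pi * k / p) : ℝ) := by
  have h1 := ZMod.stdAddChar_coe (N := p) (k : ℤ)
  have h2 := ZMod.stdAddChar_coe (N := p) (-(k : ℤ))
  push_cast at h1 h2
  rw [h1, h2, Complex.ofReal_sin, Complex.sin]
  push_cast
  have e1 : -(2 * (Real.pi : ℂ) * k / p) * Complex.I = 2 * Real.pi * Complex.I * -k / p := by ring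
  have e2 : (2 * (Real.pi : ℂ) * k / p) * Complex.I = 2 * Real.pi * Complex.I * k / p := by ring
  rw [e1, e2]
  linear_combination (Complex.exp (2 * Real.pi * Complex.I * k / p) -
    Complex.exp (2 * Real.pi * Complex.I * -k / p)) * Complex.I_sq

lemma exists_pos_prod_sin_eq {p a b : ℕ} (hp : p = 2 * (a + b) + 1)
    (ha : 4 * a < p + 2) (hb : p < 4 * a + 2) :
    ∃ R : ℝ, 0 < R ∧ ∏ r ∈ Finset.range (a + b),
      Real.sin (2 * Real.pi * (2 * r + 1 : ℕ) / p) = (-1) ^ b * R := by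
  have hp0 : (0 : ℝ) < p := by
    rw [hp]
    positivity
  have hpi := Real.pi_pos
  have hpos : ∀ k : ℕ, 0 < k → 2 * k < p → 0 < Real.sin (2 * Real.pi * k / p) := by
    intro k hk hkp
    have hk' : (0 : ℝ) < k := by exact_mod_cast hk
    have hkp' : (2 : ℝ) * k < p := by exact_mod_cast hkp
    refine Real.sin_pos_of_pos_of_lt_pi (by positivity) ?_
    rw [div_lt_iff₀ hp0]
    nlinarith
  have hneg : ∀ k : ℕ, k < p → p < 2 * k → 0 < -Real.sin (2 * Real.pi * k / p) := by
    intro k hk hkp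
    have hk' : (k : ℝ) < p := by exact_mod_cast hk
    have hkp' : (p : ℝ) < 2 * k := by exact_mod_cast hkp
    rw [← Real.sin_sub_pi]
    refine Real.sin_pos_of_pos_of_lt_pi ?_ ?_
    · rw [sub_pos, lt_div_iff₀ hp0]
      nlinarith
    · rw [sub_lt_iff_lt_add, div_lt_iff₀ hp0]
      nlinarith
  refine ⟨(∏ r ∈ Finset.range a, Real.sin (2 * Real.pi * (2 * r + 1 : ℕ) / p)) *
    ∏ r ∈ Finset.range b, -Real.sin (2 * Real.pi * (2 * (a + r) + 1 : ℕ) / p),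
    mul_pos (Finset.prod_pos fun r hr => ?_) (Finset.prod_pos fun r hr => ?_), ?_⟩
  · have := Finset.mem_range.mp hr
    exact hpos _ (by omega) (by omega)
  · have := Finset.mem_range.mp hr
    exact hneg _ (by omega) (by omega)
  · rw [Finset.prod_range_add, Finset.prod_neg, Finset.card_range, mul_left_comm,
      ← mul_assoc ((-1 : ℝ) ^ b), ← mul_pow]
    simp

/-- The direction of the quadratic Gauss sum. -/
lemma exists_pos_sum_stdAddChar_sq_eq (p : ℕ) [Fact p.Prime] (hp : p ≠ 2) :
    ∃ R : ℝ, 0 < R ∧ ∑ x : ZMod p, ZMod.stdAddChar (x ^ 2) =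
      (if p % 4 = 1 then 1 else Complex.I) * (R : ℂ) := by
  have hodd := ((Fact.out : p.Prime).eq_two_or_odd).resolve_left hp
  have hprod (m : ℕ) (hm : p = 2 * m + 1) : ∑ x : ZMod p, ZMod.stdAddChar (x ^ 2) =
      (2 * Complex.I) ^ m *
        (∏ r ∈ Finset.range m, Real.sin (2 * Real.pi * (2 * r + 1 : ℕ) / p) : ℝ) := by
    rw [sum_stdAddChar_sq_eq_prod p m hm, Complex.ofReal_prod]
    conv_rhs => rw [← Finset.card_range m, ← Finset.prod_const, Finset.card_range,
      ← Finset.prod_mul_distrib]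
    refine Finset.prod_congr rfl fun r _ => ?_
    rw [← stdAddChar_sub_stdAddChar_neg]
    push_cast
    rfl
  have hI (t : ℕ) : (2 * Complex.I) ^ (2 * t) * (-1) ^ t = 2 ^ (2 * t) := by
    rw [mul_pow, pow_mul Complex.I, Complex.I_sq, mul_assoc, ← mul_pow]
    simp
  obtain h | h : p % 4 = 1 ∨ p % 4 = 3 := by omega
  · obtain ⟨t, ht⟩ : ∃ t, p = 2 * (t + t) + 1 := ⟨p / 4, by omega⟩
    obtain ⟨R, hR, hRe⟩ := exists_pos_prod_sin_eq ht (by omega) (by omega)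
    refine ⟨2 ^ (2 * t) * R, by positivity, ?_⟩
    rw [hprod _ ht, hRe, if_pos h, ← two_mul]
    push_cast
    rw [← mul_assoc, hI, one_mul]
  · obtain ⟨t, ht⟩ : ∃ t, p = 2 * (t + 1 + t) + 1 := ⟨p / 4, by omega⟩
    obtain ⟨R, hR, hRe⟩ := exists_pos_prod_sin_eq ht (by omega) (by omega)
    refine ⟨2 ^ (2 * t + 1) * R, by positivity, ?_⟩
    rw [hprod _ ht, hRe, if_neg (by omega), show t + 1 + t = 2 * t + 1 by ring, pow_succ]
    push_cast
    linear_combination 2 * Complex.I * R * hI t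

lemma sum_stdAddChar_sq_eq_gaussSum (p : ℕ) [Fact p.Prime] (hp : p ≠ 2) :
    ∑ x : ZMod p, ZMod.stdAddChar (x ^ 2) =
      gaussSum ((quadraticChar (ZMod p)).ringHomComp (Int.castRingHom ℂ)) ZMod.stdAddChar := by
  have hchar : ringChar (ZMod p) ≠ 2 := by rwa [ZMod.ringChar_zmod_n]
  have h0 : ∑ j : ZMod p, ZMod.stdAddChar (N := p) j = 0 := by
    refine AddChar.sum_eq_zero_of_ne_one ?_
    simpa only [AddChar.mulShift_one] using ZMod.isPrimitive_stdAddChar p one_ne_zero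
  rw [← Finset.sum_fiberwise' Finset.univ (fun x : ZMod p => x ^ 2) ZMod.stdAddChar]
  have hcard (j : ZMod p) :
      ((Finset.univ.filter fun x : ZMod p => x ^ 2 = j).card : ℂ) = eta0 p j + 1 := by
    have h := quadraticChar_card_sqrts hchar j
    rw [eta0]
    norm_cast
    rw [← h]
    congr 2
    ext x
    simp
  simp_rw [Finset.sum_const, nsmul_eq_mul, hcard, add_mul, one_mul]
  rw [Finset.sum_add_distrib, h0, add_zero]
  rfl

lemma sqrtPStar_sq (p : ℕ) [Fact p.Prime] (hp : p ≠ 2) :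
    sqrtPStar p ^ 2 = eta0 p (-1) * p := by
  have hchar : ringChar (ZMod p) ≠ 2 := by rwa [ZMod.ringChar_zmod_n]
  have hodd := ((Fact.out : p.Prime).eq_two_or_odd).resolve_left hp
  have hsq : ((Real.sqrt p : ℝ) : ℂ) ^ 2 = p := by
    rw [← Complex.ofReal_pow, Real.sq_sqrt p.cast_nonneg, Complex.ofReal_natCast]
  rw [sqrtPStar, eta0, quadraticChar_neg_one hchar, ZMod.card]
  obtain h | h : p % 4 = 1 ∨ p % 4 = 3 := by omega
  · rw [if_pos h, ZMod.χ₄_nat_one_mod_four h, hsq]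
    simp
  · rw [if_neg (by omega), ZMod.χ₄_nat_three_mod_four h, mul_pow, hsq, Complex.I_sq]
    simp

/-- **Gauss's evaluation of the quadratic Gauss sum** modulo an odd prime. -/
theorem sum_eta0_mul_stdAddChar (p : ℕ) [Fact p.Prime] (hp : p ≠ 2) :
    ∑ j : ZMod p, eta0 p j * ZMod.stdAddChar j = sqrtPStar p := by
  have hchar : ringChar (ZMod p) ≠ 2 := by rwa [ZMod.ringChar_zmod_n]
  set χ := (quadraticChar (ZMod p)).ringHomComp (Int.castRingHom ℂ) with hχ
  have hgs : ∑ j : ZMod p, eta0 p j * ZMod.stdAddChar j = gaussSum χ ZMod.stdAddChar := rfl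
  obtain ⟨R, hR, hRe⟩ := exists_pos_sum_stdAddChar_sq_eq p hp
  rw [sum_stdAddChar_sq_eq_gaussSum p hp] at hRe
  have hsq : gaussSum χ ZMod.stdAddChar ^ 2 = sqrtPStar p ^ 2 := by
    rw [gaussSum_sq _ ((quadraticChar_isQuadratic _).comp _) (ZMod.isPrimitive_stdAddChar p),
      sqrtPStar_sq p hp, ZMod.card]
    · rfl
    · exact (MulChar.ringHomComp_ne_one_iff Int.cast_injective).mpr (quadraticChar_ne_one hchar)
  have hS : sqrtPStar p = (if p % 4 = 1 then 1 else Complex.I) * ((Real.sqrt p : ℝ) : ℂ) := by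
    rw [sqrtPStar]
    split_ifs <;> simp
  rw [hgs, hRe, hS]
  rw [hRe, hS, mul_pow, mul_pow] at hsq
  have hc : (if p % 4 = 1 then 1 else Complex.I) ^ 2 ≠ 0 := by
    split_ifs <;> simp
  have hsq' : R ^ 2 = Real.sqrt p ^ 2 := by exact_mod_cast mul_left_cancel₀ hc hsq
  rw [(sq_eq_sq₀ hR.le (Real.sqrt_nonneg _)).mp hsq']

/-- The only integral linear relations between the `p`-th roots of unity are the multiples of
`∑ j, ξ ^ j = 0`. -/
lemma eq_of_sum_mul_stdAddChar_eq_zero (p : ℕ) [Fact p.Prime] (c : ZMod p → ℤ)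
    (h : ∑ j : ZMod p, (c j : ℂ) * ZMod.stdAddChar j = 0) (j : ZMod p) : c j = c 0 := by
  have hpp : p.Prime := Fact.out
  obtain ⟨k, hk⟩ : ∃ k, p = k + 1 := ⟨p - 1, by have := hpp.pos; omega⟩
  set z : ℂ := ZMod.stdAddChar (1 : ZMod p) with hz
  have hprim : IsPrimitiveRoot z p := isPrimitiveRoot_stdAddChar p one_ne_zero
  have hdeg : (minpoly ℚ z).natDegree = k := by
    rw [← Polynomial.cyclotomic_eq_minpoly_rat hprim hpp.pos, Polynomial.natDegree_cyclotomic,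
      Nat.totient_prime hpp, hk, Nat.add_sub_cancel]
  have hpow (i : ℕ) : ZMod.stdAddChar (i : ZMod p) = z ^ i := by
    rw [hz, ← AddChar.map_nsmul_eq_pow, nsmul_one]
  have hgeom : ∑ i ∈ Finset.range p, z ^ i = 0 := hprim.geom_sum_eq_zero hpp.one_lt
  have hsum : ∑ i ∈ Finset.range p, ((c (i : ZMod p) - c (k : ZMod p) : ℤ) : ℂ) * z ^ i = 0 := by
    rw [← sum_range_natCast_zmod] at h
    simp_rw [hpow] at h
    simp_rw [Int.cast_sub, sub_mul]
    rw [Finset.sum_sub_distrib, h, ← Finset.mul_sum, hgeom, mul_zero, sub_zero]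
  rw [show Finset.range p = Finset.range (k + 1) from congrArg _ hk,
    Finset.sum_range_succ, sub_self, Int.cast_zero, zero_mul, add_zero,
    ← Fin.sum_univ_eq_sum_range
      (fun i => ((c (i : ZMod p) - c (k : ZMod p) : ℤ) : ℂ) * z ^ i)] at hsum
  have hli : LinearIndependent ℚ fun i : Fin k => z ^ (i : ℕ) :=
    hdeg ▸ linearIndependent_pow (K := ℚ) z
  have hzero := Fintype.linearIndependent_iff.mp hli
    (fun i => ((c ((i : ℕ) : ZMod p) - c (k : ZMod p) : ℤ) : ℚ)) (by
      simpa [Algebra.smul_def] using hsum)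
  have hall (j : ZMod p) : c j = c (k : ZMod p) := by
    rcases Nat.lt_or_ge j.val k with hj | hj
    · have := hzero ⟨j.val, hj⟩
      simp only [ZMod.natCast_zmod_val] at this
      exact sub_eq_zero.mp (by exact_mod_cast this)
    · have : j.val = k := by
        have := ZMod.val_lt j
        omega
      rw [← this, ZMod.natCast_zmod_val]
  rw [hall j, hall 0]

section ValueCount

variable {p : ℕ} [Fact p.Prime] {F : Type*} [Fintype F]

lemma sum_ep_eq_sum_card_mul (f : F → ZMod p) : ∑ x : F, ep p (f x) =
    ∑ j : ZMod p, ((Finset.univ.filter fun x : F => f x = j).card : ℂ) * ZMod.stdAddChar j := by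
  simp_rw [ep_eq_stdAddChar]
  rw [← Finset.sum_fiberwise' Finset.univ f ZMod.stdAddChar]
  simp_rw [Finset.sum_const, nsmul_eq_mul]

lemma sum_card_filter_eq (f : F → ZMod p) :
    ∑ j : ZMod p, (Finset.univ.filter fun x : F => f x = j).card = Fintype.card F :=
  (Finset.card_eq_sum_card_fiberwise fun _ _ => Finset.mem_coe.mpr (Finset.mem_univ _)).symm

/-- If `∑ x, ξ ^ f x = ∑ j, a j * ξ ^ j` with integers `a j`, the value distribution of `f`
differs from `a` by a constant. -/
lemma mul_card_filter_eq_of_sum_ep_eq (f : F → ZMod p) (a : ZMod p → ℤ)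
    (h : ∑ x : F, ep p (f x) = ∑ j : ZMod p, (a j : ℂ) * ZMod.stdAddChar j) (j : ZMod p) :
    (p : ℂ) * (Finset.univ.filter fun x : F => f x = j).card =
      Fintype.card F - ∑ i : ZMod p, (a i : ℂ) + p * a j := by
  set N : ZMod p → ℕ := fun j => (Finset.univ.filter fun x : F => f x = j).card with hN
  have hc := eq_of_sum_mul_stdAddChar_eq_zero p (fun j => (N j : ℤ) - a j) (by
    rw [sum_ep_eq_sum_card_mul] at h
    push_cast
    simp_rw [sub_mul]
    rw [Finset.sum_sub_distrib, h, sub_self])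
  have hsum : ∑ i : ZMod p, ((N i : ℤ) - a i) = p * ((N j : ℤ) - a j) := by
    rw [Finset.sum_congr rfl fun i _ => (hc i).trans (hc j).symm, Finset.sum_const,
      Finset.card_univ, ZMod.card, nsmul_eq_mul]
  rw [Finset.sum_sub_distrib, ← Nat.cast_sum, sum_card_filter_eq f] at hsum
  have := congrArg (Int.cast (R := ℂ)) hsum
  push_cast at this
  linear_combination -this

end ValueCount

lemma walsh_zero (p : ℕ) {F : Type*} [Field F] [Fintype F] [Algebra (ZMod p) F]
    (f : F → ZMod p) : walsh p f 0 = ∑ x : F, ep p (f x) := by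
  simp [walsh]

lemma exists_int_eq_mul_sqrtPStar_pow (p : ℕ) [Fact p.Prime] (hp : p ≠ 2) {ε : ℂ}
    (hε : ε = 1 ∨ ε = -1) {k : ℕ} (hk : Even k) : ∃ A : ℤ, (A : ℂ) = ε * sqrtPStar p ^ k := by
  obtain ⟨e, rfl⟩ : ∃ e : ℤ, (e : ℂ) = ε := by
    rcases hε with rfl | rfl
    · exact ⟨1, by simp⟩
    · exact ⟨-1, by simp⟩
  obtain ⟨m, rfl⟩ := hk.two_dvd
  refine ⟨e * (quadraticChar (ZMod p) (-1) * p) ^ m, ?_⟩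
  rw [pow_mul, sqrtPStar_sq p hp, eta0]
  push_cast
  rfl

theorem statement_5 (p n s : ℕ) [Fact p.Prime] (hp : p ≠ 2) (hn : 0 < n) (hs : s ≤ n)
    {F : Type*} [Field F] [Fintype F] [Algebra (ZMod p) F]
    (hq : Fintype.card F = p ^ n)
    (f : F → ZMod p) (ε : ℂ) (hε : ε = 1 ∨ ε = -1)
    (hW0 : walsh p f 0 = ε * sqrtPStar p ^ (n + s)) :
    (Even (n + s) →
      ((Finset.univ.filter fun x : F => f x = 0).card : ℂ)
          = (p : ℂ) ^ (n - 1)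
            + ε * eta0 p (-1) * ((p : ℂ) - 1) * sqrtPStar p ^ (n + s - 2) ∧
      ∀ j : ZMod p, j ≠ 0 →
        ((Finset.univ.filter fun x : F => f x = j).card : ℂ)
          = (p : ℂ) ^ (n - 1) - ε * eta0 p (-1) * sqrtPStar p ^ (n + s - 2)) ∧
    (Odd (n + s) →
      ((Finset.univ.filter fun x : F => f x = 0).card : ℂ) = (p : ℂ) ^ (n - 1) ∧
      (∀ j : ZMod p, j ≠ 0 → IsSquare j →
        ((Finset.univ.filter fun x : F => f x = j).card : ℂ)
          = (p : ℂ) ^ (n - 1) + ε * sqrtPStar p ^ (n + s - 1)) ∧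
      (∀ j : ZMod p, j ≠ 0 → ¬ IsSquare j →
        ((Finset.univ.filter fun x : F => f x = j).card : ℂ)
          = (p : ℂ) ^ (n - 1) - ε * sqrtPStar p ^ (n + s - 1))) := by
  have hp0 : (p : ℂ) ≠ 0 := by exact_mod_cast (Fact.out : p.Prime).ne_zero
  have hchar : ringChar (ZMod p) ≠ 2 := by rwa [ZMod.ringChar_zmod_n]
  have hpn : (p : ℂ) ^ n = p * p ^ (n - 1) := by rw [mul_pow_sub_one hn.ne']
  rw [walsh_zero] at hW0
  refine ⟨fun heven => ?_, fun hodd => ?_⟩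
  · obtain ⟨A, hA⟩ := exists_int_eq_mul_sqrtPStar_pow p hp hε heven
    have hcount := mul_card_filter_eq_of_sum_ep_eq f (Pi.single 0 A) (by
      rw [hW0, ← hA, Finset.sum_eq_single 0]
      · simp
      · intro j _ hj
        simp [hj]
      · simp)
    have hAsum : ∑ i : ZMod p, ((Pi.single 0 A : ZMod p → ℤ) i : ℂ) = A := by
      rw [← Int.cast_sum, Finset.sum_pi_single']
      simp
    have hA' : (A : ℂ) = p * (ε * eta0 p (-1) * sqrtPStar p ^ (n + s - 2)) := by
      obtain ⟨k, hk⟩ : ∃ k, n + s = k + 2 := ⟨n + s - 2, by have := heven.two_dvd; omega⟩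
      rw [hA, hk, Nat.add_sub_cancel, pow_add, sqrtPStar_sq p hp]
      ring
    rw [hAsum, hq, Nat.cast_pow, hpn] at hcount
    refine ⟨mul_left_cancel₀ hp0 ?_, fun j hj => mul_left_cancel₀ hp0 ?_⟩
    · rw [hcount, Pi.single_eq_same, hA']
      ring
    · rw [hcount, Pi.single_eq_of_ne hj, hA', Int.cast_zero]
      ring
  · obtain ⟨k, hk⟩ : ∃ k, n + s = k + 1 := ⟨n + s - 1, by omega⟩
    have hkeven : Even k := by
      rw [hk] at hodd
      simpa [Nat.odd_add_one] using hodd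
    obtain ⟨B, hB⟩ := exists_int_eq_mul_sqrtPStar_pow p hp hε hkeven
    have hcount := mul_card_filter_eq_of_sum_ep_eq f (fun j => B * quadraticChar (ZMod p) j) (by
      rw [hW0, hk, pow_succ, ← mul_assoc, ← hB, ← sum_eta0_mul_stdAddChar p hp, Finset.mul_sum]
      refine Finset.sum_congr rfl fun j _ => ?_
      rw [eta0, Int.cast_mul, mul_assoc])
    have hBsum : ∑ i : ZMod p, ((B * quadraticChar (ZMod p) i : ℤ) : ℂ) = 0 := by
      rw [← Int.cast_sum, ← Finset.mul_sum, quadraticChar_sum_zero hchar, mul_zero, Int.cast_zero]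
    rw [hBsum, hq, Nat.cast_pow, hpn] at hcount
    rw [hk, Nat.add_sub_cancel, ← hB]
    refine ⟨mul_left_cancel₀ hp0 ?_, fun j hj hsq => mul_left_cancel₀ hp0 ?_,
      fun j hj hsq => mul_left_cancel₀ hp0 ?_⟩
    · rw [hcount, quadraticChar_zero]
      simp
    · rw [hcount, (quadraticChar_one_iff_isSquare hj).mpr hsq]
      push_cast
      ring
    · rw [hcount, quadraticChar_neg_one_iff_not_isSquare.mpr hsq]
      push_cast
      ring
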